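/- Let R be a commutative ring and a, b, c, d, q ∈ R. For every natural number n: W_n(a,b,c,d;q) = Σ_{k=0}^{n} P_{n,k}(c,d) · W*_k(a,b,c;q). Here W_n(a,b,c,d;q) is the total weight of all labelled Motzkin paths of length n, W*_k(a,b,c;q) is the total weight of those labelled Motzkin paths of length k containing no level step labelled d and no peak (an up step immediately followed by a down step) whose up step is labelled 1 and whose down step is labelled c, and P_{n,k}(c,d) = Σ over Motzkin prefixes of length n and final height k of c^{(number of down steps)} · d^{(number of level steps)}. -/

import Mathlib

open Finset

inductive Step : Type
  | U | L | D
deriving DecidableEq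

instance : Fintype Step :=
  ⟨{Step.U, Step.L, Step.D}, by intro x; cases x <;> simp⟩

/-- The vertical displacement of a step: up = +1, level = 0, down = -1. -/
def Step.val : Step → ℤ
  | .U => 1
  | .L => 0
  | .D => -1

/-- The partial sum of the step values of the first `i` steps;
this is the height at which step `i` starts. -/
def hsum {n : ℕ} (P : Fin n → Step) (i : ℕ) : ℤ :=
  ∑ j ∈ Finset.univ.filter (fun j : Fin n => (j : ℕ) < i), (P j).val

/-- A Motzkin path: all partial sums nonnegative and total sum 0. -/
abbrev IsMotzkin {n : ℕ} (P : Fin n → Step) : Prop :=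
  (∀ i : Fin (n+1), 0 ≤ hsum P (i : ℕ)) ∧ hsum P n = 0

/-- A Motzkin prefix of final height `k`: all partial sums nonnegative, total sum `k`. -/
abbrev IsMPrefix {n : ℕ} (P : Fin n → Step) (k : ℕ) : Prop :=
  (∀ i : Fin (n+1), 0 ≤ hsum P (i : ℕ)) ∧ hsum P n = (k : ℤ)

/-- `[h]_q = 1 + q + ... + q^(h-1)`. -/
def geo {R : Type*} [CommSemiring R] (q : R) (h : ℤ) : R :=
  ∑ i ∈ Finset.range h.toNat, q ^ i

/-- The Gaussian (q-)binomial coefficient, via the q-Pascal recurrence. -/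
def qbinom {R : Type*} [CommSemiring R] (q : R) : ℕ → ℕ → R
  | _, 0 => 1
  | 0, _+1 => 0
  | n+1, k+1 => qbinom q n k + q ^ (k+1) * qbinom q n (k+1)

/-- The binomial coefficient with integer lower argument, zero on negative arguments. -/
def ch (m : ℕ) (j : ℤ) : ℤ := if 0 ≤ j then m.choose j.toNat else 0

/-- The weight of step `i` of a labelled Motzkin path `(P, w)`: the label `w i`
chooses one of the two admissible weights for each step.  An up step starting at
height `h` has weight `1` or `-q^(h+1)`, a level step has weight `d` or
`(a+b)·q^h`, and a down step has weight `c` or `-a·b·q^(h-1)`. -/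
def wtM {R : Type*} [CommRing R] (a b c d q : R) {m : ℕ}
    (P : Fin m → Step) (w : Fin m → Bool) (i : Fin m) : R :=
  match P i, w i with
  | Step.U, true  => 1
  | Step.U, false => -q ^ ((hsum P (i : ℕ)).toNat + 1)
  | Step.L, true  => d
  | Step.L, false => (a + b) * q ^ (hsum P (i : ℕ)).toNat
  | Step.D, true  => c
  | Step.D, false => -(a * b) * q ^ (hsum P (i : ℕ) - 1).toNat

lemma hsum_cons_zero {n : ℕ} (P : Fin n → Step) : hsum P 0 = 0 := by
  simp [hsum]

lemma hsum_cons_succ {n : ℕ} (s : Step) (P : Fin n → Step) (i : ℕ) :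
    hsum (Fin.cons s P : Fin (n+1) → Step) (i+1) = s.val + hsum P i := by
  simp only [hsum, Finset.sum_filter, Fin.sum_univ_succ]
  simp

def Nn {n : ℕ} (h e : ℤ) (P : Fin n → Step) : Prop :=
  (∀ i : Fin (n+1), 0 ≤ h + hsum P (i : ℕ)) ∧ h + hsum P n = e

lemma Nn_cons {n : ℕ} (h e : ℤ) (s : Step) (P : Fin n → Step) :
    Nn h e (Fin.cons s P : Fin (n+1) → Step) ↔ 0 ≤ h ∧ Nn (h + s.val) e P := by
  unfold Nn
  rw [Fin.forall_fin_succ]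
  simp only [Fin.val_succ, hsum_cons_succ, Fin.val_zero, hsum_cons_zero, add_zero, ← add_assoc,
    and_assoc]

lemma Nn_zero (h e : ℤ) (he : 0 ≤ e) (P : Fin 0 → Step) : Nn h e P ↔ h = e := by
  unfold Nn
  simp [hsum]
  omega

lemma sumcons {α R : Type*} [Fintype α] [AddCommMonoid R] {n : ℕ} (f : (Fin (n+1) → α) → R) :
    ∑ P, f P = ∑ s, ∑ P : Fin n → α, f (Fin.cons s P) := by
  rw [← (Fin.consEquiv (fun _ : Fin (n+1) => α)).sum_comp, Fintype.sum_prod_type]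
  rfl

lemma sum_step {R : Type*} [AddCommMonoid R] (f : Step → R) :
    ∑ s, f s = f .U + f .L + f .D := by
  have : (Finset.univ : Finset Step) = {Step.U, Step.L, Step.D} := rfl
  rw [this]
  simp [add_assoc]

section
variable {R : Type*} [CommRing R] (a b c d q : R)

def om (h : ℤ) (s : Step) (b' : Bool) : R :=
  match s, b' with
  | Step.U, true  => 1
  | Step.U, false => -q ^ (h.toNat + 1)
  | Step.L, true  => d
  | Step.L, false => (a + b) * q ^ h.toNat
  | Step.D, true  => c
  | Step.D, false => -(a * b) * q ^ (h - 1).toNat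

lemma wtM_eq {m : ℕ} (P : Fin m → Step) (w : Fin m → Bool) (i : Fin m) :
    wtM a b c d q P w i = om a b c d q (0 + hsum P i) (P i) (w i) := by
  rw [zero_add]; rfl

lemma prodcons {n : ℕ} (h : ℤ) (s : Step) (t : Bool) (P : Fin n → Step) (w : Fin n → Bool) :
    ∏ i : Fin (n+1), om a b c d q (h + hsum (Fin.cons s P : Fin (n+1) → Step) i)
      ((Fin.cons s P : Fin (n+1) → Step) i) ((Fin.cons t w : Fin (n+1) → Bool) i)
    = om a b c d q h s t * ∏ i : Fin n, om a b c d q (h + s.val + hsum P i) (P i) (w i) := by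
  rw [Fin.prod_univ_succ]
  simp [hsum_cons_succ, hsum_cons_zero, add_assoc]

def T : (ℤ → R) →ₗ[R] (ℤ → R) where
  toFun f h := if 0 ≤ h then ∑ s : Step, ∑ t : Bool, om a b c d q h s t * f (h + s.val) else 0
  map_add' f g := by
    ext h
    by_cases hh : 0 ≤ h <;> simp [hh, mul_add, Finset.sum_add_distrib]
  map_smul' r f := by
    ext h
    by_cases hh : 0 ≤ h <;> simp [hh, Finset.mul_sum]
    simp [mul_left_comm, mul_add]

def del : ℤ → R := fun h => if h = 0 then 1 else 0

open Classical in
lemma bridgeF (n : ℕ) (h : ℤ) :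
    (∑ P : Fin n → Step, ∑ w : Fin n → Bool, if Nn h 0 P then
      ∏ i : Fin n, om a b c d q (h + hsum P i) (P i) (w i) else 0) = ((T a b c d q)^n) del h := by
  induction n generalizing h with
  | zero => simp [Nn_zero, del]
  | succ n ih =>
    rw [pow_succ', sumcons]
    simp only [sumcons (α := Bool), prodcons, Nn_cons]
    simp only [Module.End.mul_apply, T, LinearMap.coe_mk, AddHom.coe_mk]
    by_cases hh : 0 ≤ h
    · simp only [hh, true_and, if_true]
      refine Finset.sum_congr rfl fun s _ => ?_
      rw [Finset.sum_comm]
      refine Finset.sum_congr rfl fun t _ => ?_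
      have := ih (h + s.val)
      simp only [T] at this
      rw [← this]
      simp only [Finset.mul_sum, mul_ite, mul_zero]
    · simp [hh]

def Ok (p : Bool) (s : Step) (t : Bool) : Prop :=
  (s = .L → t = false) ∧ ¬ (p = true ∧ s = .D ∧ t = true)

instance (p s t) : Decidable (Ok p s t) := by unfold Ok; infer_instance

def nx (s : Step) (t : Bool) : Bool := decide (s = .U ∧ t = true)

def G : ℕ → ℤ → Bool → R
  | 0, h, _ => del h
  | k+1, h, p => if 0 ≤ h then ∑ s : Step, ∑ t : Bool,
      (if Ok p s t then om a b c d q h s t * G k (h + s.val) (nx s t) else 0) else 0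

def Good {k : ℕ} (p : Bool) (P : Fin k → Step) (w : Fin k → Bool) : Prop :=
  (∀ i, P i = Step.L → w i = false) ∧
    (∀ i j : Fin k, (j : ℕ) = (i : ℕ) + 1 →
      ¬(P i = Step.U ∧ P j = Step.D ∧ w i = true ∧ w j = true)) ∧
    (∀ j : Fin k, (j : ℕ) = 0 → ¬ (p = true ∧ P j = .D ∧ w j = true))

lemma Good_cons {k : ℕ} (p : Bool) (s : Step) (t : Bool) (P : Fin k → Step) (w : Fin k → Bool) :
    Good p (Fin.cons s P : Fin (k+1) → Step) (Fin.cons t w : Fin (k+1) → Bool) ↔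
      Ok p s t ∧ Good (nx s t) P w := by
  unfold Good Ok nx
  simp only [Fin.forall_fin_succ (n := k), Fin.cons_zero, Fin.cons_succ, Fin.val_succ, Fin.val_zero]
  simp
  grind

open Classical in
lemma bridgeG (n : ℕ) (h : ℤ) (p : Bool) :
    (∑ P : Fin n → Step, ∑ w : Fin n → Bool, if Nn h 0 P ∧ Good p P w then
      ∏ i : Fin n, om a b c d q (h + hsum P i) (P i) (w i) else 0) = G a b c d q n h p := by
  induction n generalizing h p with
  | zero => simp [Nn_zero, del, G, Good]
  | succ n ih =>
    rw [sumcons]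
    simp only [sumcons (α := Bool), prodcons, Nn_cons, Good_cons, G]
    by_cases hh : 0 ≤ h
    · simp only [hh, true_and, if_true]
      refine Finset.sum_congr rfl fun s _ => ?_
      rw [Finset.sum_comm]
      refine Finset.sum_congr rfl fun t _ => ?_
      rw [← ih (h + s.val)]
      by_cases ho : Ok p s t
      · simp only [ho, true_and, if_true, Finset.mul_sum, mul_ite, mul_zero]
      · simp [ho]
    · simp [hh]

def pw (s : Step) : R := match s with
  | .U => 1
  | .L => d
  | .D => c

def Q : ℕ → ℤ → ℤ → R
  | 0, h, k => if h = k then 1 else 0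
  | n+1, h, k => if 0 ≤ h then ∑ s : Step, pw c d s * Q n (h + s.val) k else 0

open Classical in
lemma bridgeQ (n : ℕ) (h : ℤ) (k : ℤ) (hk : 0 ≤ k) :
    (∑ P : Fin n → Step, if Nn h k P then ∏ i, pw c d (P i) else 0) = Q c d n h k := by
  induction n generalizing h with
  | zero => simp [Nn_zero, hk, Q]
  | succ n ih =>
    rw [sumcons]
    simp only [Nn_cons, Q, Fin.prod_univ_succ, Fin.cons_zero, Fin.cons_succ]
    by_cases hh : 0 ≤ h
    · simp only [hh, true_and, if_true]
      refine Finset.sum_congr rfl fun s _ => ?_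
      rw [← ih (h + s.val)]
      simp only [Finset.mul_sum, mul_ite, mul_zero]
    · simp [hh]

lemma pw_prod {n : ℕ} (P : Fin n → Step) :
    c ^ (Finset.univ.filter (fun i => P i = Step.D)).card *
          d ^ (Finset.univ.filter (fun i => P i = Step.L)).card = ∏ i, pw c d (P i) := by
  rw [← Finset.prod_const, ← Finset.prod_const, Finset.prod_filter, Finset.prod_filter,
    ← Finset.prod_mul_distrib]
  refine Finset.prod_congr rfl fun i _ => ?_
  cases P i <;> simp [pw]

lemma G_neg (k : ℕ) (h : ℤ) (p : Bool) (hh : ¬ 0 ≤ h) : G a b c d q k h p = 0 := by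
  cases k with
  | zero => simp only [G, del]; rw [if_neg]; omega
  | succ k => simp [G, hh]

lemma G_true (k : ℕ) (h : ℤ) (hh : 0 ≤ h) : G a b c d q (k+1) h true
    = G a b c d q (k+1) h false - c * G a b c d q k (h-1) false := by
  simp [G, hh, sum_step, Ok, nx, om, Step.val]
  ring_nf

lemma TG0 : T a b c d q (fun h => G a b c d q 0 h false) =
    (fun h => G a b c d q 1 h false) + d • (fun h => G a b c d q 0 h false) := by
  ext h
  by_cases hh : 0 ≤ h
  · simp [T, G, hh, sum_step, Ok, nx, om, Step.val]
    ring
  · simp [T, hh, G_neg]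

lemma TGs (k : ℕ) : T a b c d q (fun h => G a b c d q (k+1) h false) =
    (fun h => G a b c d q (k+2) h false) + d • (fun h => G a b c d q (k+1) h false)
     + c • (fun h => G a b c d q k h false) := by
  ext h
  by_cases hh : 0 ≤ h
  · have := G_true a b c d q k (h+1) (by omega)
    rw [add_sub_cancel_right] at this
    have e : G a b c d q (k+2) h false = if 0 ≤ h then ∑ s : Step, ∑ t : Bool,
      (if Ok false s t then om a b c d q h s t * G a b c d q (k+1) (h + s.val) (nx s t) else 0) else 0 := by
      rw [G]
    simp only [Pi.add_apply, Pi.smul_apply, e]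
    simp [T, hh, sum_step, Ok, nx, om, Step.val, this]
    ring
  · simp [T, hh, G_neg]

lemma Q_neg (n : ℕ) (k : ℕ) : Q c d n (-1) k = 0 := by
  cases n <;> simp [Q]

lemma Q_succ (n j : ℕ) (k : ℤ) : Q c d (n+1) j k =
    Q c d n (j+1 : ℕ) k + d * Q c d n j k + c * Q c d n ((j:ℤ)-1) k := by
  simp [Q, sum_step, pw, Step.val, sub_eq_add_neg]

lemma key (n j N : ℕ) (hN : n + j < N) :
    ((T a b c d q)^n) (fun h => G a b c d q j h false) =
      ∑ k ∈ Finset.range N, Q c d n j k • (fun h => G a b c d q k h false) := by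
  induction n generalizing j with
  | zero =>
    simp only [Q, pow_zero, Module.End.one_apply, Nat.cast_inj, ite_smul, one_smul, zero_smul]
    rw [Finset.sum_ite_eq, if_pos (by simp; omega)]
  | succ n ih =>
    rw [pow_succ, Module.End.mul_apply]
    simp only [Q_succ, add_smul, Finset.sum_add_distrib, mul_smul, ← Finset.smul_sum]
    cases j with
    | zero =>
      rw [TG0, map_add, map_smul, ih 0 (by omega), ih 1 (by omega)]
      simp [Q_neg]
    | succ j =>
      rw [TGs, map_add, map_add, map_smul, map_smul, ih j (by omega), ih (j+1) (by omega),
        ih (j+2) (by omega)]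
      simp [add_assoc, one_add_one_eq_two]
end

/-- Penaud's decomposition: the total weight `W_n(a,b,c,d;q)` of labelled Motzkin
paths of length `n` equals `∑_k P_{n,k}(c,d) · W*_k(a,b,c;q)`, where
`P_{n,k}(c,d)` counts Motzkin prefixes of final height `k` with weight `c` on
down steps and `d` on level steps, and `W*_k` is the total weight of labelled
Motzkin paths with no level step labelled `d` and no peak labelled `(1, c)`. -/
theorem stmt8 {R : Type*} [CommRing R] (a b c d q : R) (n : ℕ) :
    (∑ pw ∈ Finset.univ.filter
        (fun pw : (Fin n → Step) × (Fin n → Bool) => IsMotzkin pw.1),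
      ∏ i, wtM a b c d q pw.1 pw.2 i)
    = ∑ k ∈ Finset.range (n+1),
        (∑ P ∈ Finset.univ.filter (fun P : Fin n → Step => IsMPrefix P k),
          c ^ (Finset.univ.filter (fun i => P i = Step.D)).card *
          d ^ (Finset.univ.filter (fun i => P i = Step.L)).card) *
        (∑ pw ∈ Finset.univ.filter
            (fun pw : (Fin k → Step) × (Fin k → Bool) =>
              IsMotzkin pw.1 ∧ (∀ i, pw.1 i = Step.L → pw.2 i = false) ∧
              ∀ i j : Fin k, (j : ℕ) = (i : ℕ) + 1 →
                ¬(pw.1 i = Step.U ∧ pw.1 j = Step.D ∧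
                  pw.2 i = true ∧ pw.2 j = true)),
          ∏ i, wtM a b c d q pw.1 pw.2 i) := by
  classical
  have hF := bridgeF a b c d q n 0
  have hk := congrFun (key a b c d q n 0 (n+1) (by omega)) 0
  have e1 : (fun h => G a b c d q 0 h false) = del := by ext h; simp [G]
  rw [e1, ← hF] at hk
  rw [Finset.sum_filter, Fintype.sum_prod_type]
  simp only [wtM_eq, pw_prod]
  refine Eq.trans ?_ (hk.trans ?_)
  · simp [Nn]
  · rw [Finset.sum_apply]
    refine Finset.sum_congr rfl fun k _ => ?_
    rw [Pi.smul_apply, smul_eq_mul, ← bridgeG, Nat.cast_zero, ← bridgeQ c d n 0 k (by simp)]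
    congr 1
    · rw [Finset.sum_filter]
      simp [Nn]
    · rw [Finset.sum_filter, Fintype.sum_prod_type]
      simp [Nn, Good]
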